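/- There exists a constant C > 0 such that for all (m, κ, K) ∈ [m₁, ∞) × [−A, A] × [−B, B], the minimal value Λ_{m,κ,K} of the one-dimensional weighted variational problem satisfies |Λ_{m,κ,K} − (1 + κ/(2m) + m⁻²(K/2 − κ²/8))| ≤ C m⁻³. -/

import Mathlib

open Set MeasureTheory

/-- The weight function `a_{m,κ,K}(τ) = 1 + τκ/m + τ²K/m²`. -/
noncomputable def wt (m κ K τ : ℝ) : ℝ := 1 + τ * κ / m + τ ^ 2 * K / m ^ 2

/-- `u ∈ H¹((0,R); ℂ)` with distributional derivative `g`, expressed through the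
continuous representative: `g ∈ L²(0,R)` and `u(x) = u(0) + ∫₀ˣ g` on `[0,R]`. -/
def IsH1On (R : ℝ) (u g : ℝ → ℂ) : Prop :=
  MemLp g 2 (volume.restrict (Ioc (0 : ℝ) R)) ∧
  ∀ x ∈ Icc (0 : ℝ) R, u x = u 0 + ∫ t in Ioc (0 : ℝ) x, g t

/-- Membership in the admissible set `V̂_{m,κ,K}`. -/
def Adm (m : ℝ) (u g : ℝ → ℂ) : Prop :=
  IsH1On (Real.sqrt m) u g ∧ u 0 = 1 ∧ u (Real.sqrt m) = 0

/-- The weighted energy `Q̂_{m,κ,K}(u) = ∫₀^{√m} (|u'|² + |u|²) a_{m,κ,K} dτ`. -/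
noncomputable def energy (m κ K : ℝ) (u g : ℝ → ℂ) : ℝ :=
  ∫ τ in Ioc (0 : ℝ) (Real.sqrt m), (‖g τ‖ ^ 2 + ‖u τ‖ ^ 2) * wt m κ K τ

/-- `Λ_{m,κ,K}`, the infimum of the energy over the admissible set. -/
noncomputable def lam (m κ K : ℝ) : ℝ :=
  sInf {E : ℝ | ∃ u g : ℝ → ℂ, Adm m u g ∧ E = energy m κ K u g}

/-- Integration by parts for `φ v²`, where `v` is the primitive of an integrable function. -/
theorem integral_deriv_mul_sq_primitive {R c : ℝ} {h φ φ' : ℝ → ℝ}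
    (hh : IntervalIntegrable h volume 0 R) (hφ : ∀ t, HasDerivAt φ (φ' t) t)
    (hφ' : Continuous φ') :
    ∫ t in (0 : ℝ)..R, (φ' t * (c + ∫ s in (0 : ℝ)..t, h s) ^ 2
      + 2 * φ t * ((c + ∫ s in (0 : ℝ)..t, h s) * h t))
      = φ R * (c + ∫ s in (0 : ℝ)..R, h s) ^ 2 - φ 0 * c ^ 2 := by
  have hφC : ContDiff ℝ 1 φ := by
    rw [contDiff_one_iff_deriv]
    exact ⟨fun t => (hφ t).differentiableAt, by rwa [funext fun t => (hφ t).deriv]⟩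
  have hφac : AbsolutelyContinuousOnInterval φ 0 R :=
    hφC.contDiffOn.absolutelyContinuousOnInterval
  have hcac : AbsolutelyContinuousOnInterval (fun _ : ℝ => c) 0 R :=
    (contDiff_const (n := 1)).contDiffOn.absolutelyContinuousOnInterval
  have hvac : AbsolutelyContinuousOnInterval (fun t => c + ∫ s in (0 : ℝ)..t, h s) 0 R :=
    hcac.add (hh.absolutelyContinuousOnInterval_intervalIntegral (by simp))
  have key := ((hφac.mul hvac).mul hvac).integral_deriv_eq_sub
  simp only [Pi.mul_apply, intervalIntegral.integral_same, add_zero] at key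
  rw [show φ R * (c + ∫ s in (0 : ℝ)..R, h s) ^ 2 - φ 0 * c ^ 2 =
    φ R * (c + ∫ s in (0 : ℝ)..R, h s) * (c + ∫ s in (0 : ℝ)..R, h s) - φ 0 * c * c by ring,
    ← key]
  apply intervalIntegral.integral_congr_ae
  filter_upwards [hh.ae_hasDerivAt_integral] with t ht htR
  have hv : HasDerivAt (fun t => c + ∫ s in (0 : ℝ)..t, h s) (h t) t := by
    simpa using (ht (uIoc_subset_uIcc htR) 0 (by simp)).const_add c
  have := (((hφ t).mul hv).mul hv).deriv
  rw [this]
  simp only [Pi.mul_apply]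
  ring

theorem IsH1On.continuousOn {R : ℝ} {u g : ℝ → ℂ} (hu : IsH1On R u g) :
    ContinuousOn u (Icc 0 R) := by
  have hg : IntegrableOn g (Icc 0 R) := by
    rw [integrableOn_Icc_iff_integrableOn_Ioc]
    exact hu.1.integrable (by norm_num)
  exact (continuousOn_const.add (intervalIntegral.continuousOn_primitive hg)).congr hu.2

/-- Completing the square in the weighted energy by means of a function `w`; the coefficient of
`‖u‖²` that remains is the defect of `w` in the associated Riccati equation. -/
theorem weighted_energy_eq {R : ℝ} (hR : 0 ≤ R) {a a' w w' : ℝ → ℝ}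
    (ha : ∀ t, HasDerivAt a (a' t) t) (hw : ∀ t, HasDerivAt w (w' t) t)
    (ha' : Continuous a') (hw' : Continuous w') {u g : ℝ → ℂ} (hu : IsH1On R u g)
    (h0 : u 0 = 1) (hR0 : u R = 0) :
    ∫ t in Ioc (0 : ℝ) R, (‖g t‖ ^ 2 + ‖u t‖ ^ 2) * a t = a 0 * w 0 +
      ∫ t in Ioc (0 : ℝ) R, (a t * ‖g t + w t * u t‖ ^ 2 +
        (a t + (a' t * w t + a t * w' t) - a t * w t ^ 2) * ‖u t‖ ^ 2) := by
  have hac : Continuous a := continuous_iff_continuousAt.2 fun t => (ha t).continuousAt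
  have hwc : Continuous w := continuous_iff_continuousAt.2 fun t => (hw t).continuousAt
  have hφ : ∀ t, HasDerivAt (fun t => a t * w t) (a' t * w t + a t * w' t) t :=
    fun t => (ha t).mul (hw t)
  have hφ' : Continuous fun t => a' t * w t + a t * w' t := by fun_prop
  have hg2 : IntegrableOn (fun t => ‖g t‖ ^ 2) (Ioc 0 R) := hu.1.integrable_norm_pow (by norm_num)
  have hg1 : IntegrableOn g (Ioc 0 R) := hu.1.integrable (by norm_num)
  have mulc : ∀ {f b : ℝ → ℝ}, IntegrableOn f (Ioc 0 R) → ContinuousOn b (Icc 0 R) →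
      IntegrableOn (fun t => b t * f t) (Ioc 0 R) := by
    intro f b hf hb
    rw [← integrableOn_Icc_iff_integrableOn_Ioc] at hf ⊢
    exact hf.continuousOn_mul hb isCompact_Icc
  have huc := hu.continuousOn
  have hu2 : IntegrableOn (fun t => ‖u t‖ ^ 2) (Ioc 0 R) :=
    ((huc.norm.pow 2).integrableOn_compact isCompact_Icc).mono_set Ioc_subset_Icc_self
  have hre : IntegrableOn (fun t => (g t).re) (Ioc 0 R) := hg1.re
  have him : IntegrableOn (fun t => (g t).im) (Ioc 0 R) := hg1.im
  have hure : ContinuousOn (fun t => (u t).re) (Icc 0 R) :=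
    Complex.continuous_re.comp_continuousOn huc
  have huim : ContinuousOn (fun t => (u t).im) (Icc 0 R) :=
    Complex.continuous_im.comp_continuousOn huc
  have eqre : ∀ t ∈ Icc 0 R, (u t).re = 1 + ∫ s in (0 : ℝ)..t, (g s).re := by
    intro t ht
    have hgt : IntegrableOn g (Ioc 0 t) := hg1.mono_set (Ioc_subset_Ioc_right ht.2)
    rw [hu.2 t ht, h0, intervalIntegral.integral_of_le ht.1]
    have := integral_re (𝕜 := ℂ) hgt
    simp only [RCLike.re_to_complex] at this
    simp [this]
  have eqim : ∀ t ∈ Icc 0 R, (u t).im = 0 + ∫ s in (0 : ℝ)..t, (g s).im := by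
    intro t ht
    have hgt : IntegrableOn g (Ioc 0 t) := hg1.mono_set (Ioc_subset_Ioc_right ht.2)
    rw [hu.2 t ht, h0, intervalIntegral.integral_of_le ht.1]
    have := integral_im (𝕜 := ℂ) hgt
    simp only [RCLike.im_to_complex] at this
    simp [this]
  have Ire := integral_deriv_mul_sq_primitive (c := 1)
    ((intervalIntegrable_iff_integrableOn_Ioc_of_le hR).2 hre) hφ hφ'
  have Iim := integral_deriv_mul_sq_primitive (c := 0)
    ((intervalIntegrable_iff_integrableOn_Ioc_of_le hR).2 him) hφ hφ'
  rw [← eqre R ⟨hR, le_rfl⟩, hR0, intervalIntegral.integral_of_le hR,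
    setIntegral_congr_fun measurableSet_Ioc (g := fun t => (a' t * w t + a t * w' t) * (u t).re ^ 2
      + 2 * (a t * w t) * ((u t).re * (g t).re))
      (fun t ht => by simp only [eqre t (Ioc_subset_Icc_self ht)])] at Ire
  rw [← eqim R ⟨hR, le_rfl⟩, hR0, intervalIntegral.integral_of_le hR,
    setIntegral_congr_fun measurableSet_Ioc (g := fun t => (a' t * w t + a t * w' t) * (u t).im ^ 2
      + 2 * (a t * w t) * ((u t).im * (g t).im))
      (fun t ht => by simp only [eqim t (Ioc_subset_Icc_self ht)])] at Iim
  have i1 : IntegrableOn (fun t => (a' t * w t + a t * w' t) * (u t).re ^ 2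
      + 2 * (a t * w t) * ((u t).re * (g t).re)) (Ioc 0 R) := by
    refine Integrable.add ?_ (mulc (mulc hre hure) (by fun_prop))
    exact ((hφ'.continuousOn.mul (hure.pow 2)).integrableOn_compact isCompact_Icc).mono_set
      Ioc_subset_Icc_self
  have i2 : IntegrableOn (fun t => (a' t * w t + a t * w' t) * (u t).im ^ 2
      + 2 * (a t * w t) * ((u t).im * (g t).im)) (Ioc 0 R) := by
    refine Integrable.add ?_ (mulc (mulc him huim) (by fun_prop))
    exact ((hφ'.continuousOn.mul (huim.pow 2)).integrableOn_compact isCompact_Icc).mono_set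
      Ioc_subset_Icc_self
  have i3 : IntegrableOn (fun t => (‖g t‖ ^ 2 + ‖u t‖ ^ 2) * a t) (Ioc 0 R) := by
    refine (mulc (hg2.add hu2) hac.continuousOn).congr_fun (fun t _ => ?_) measurableSet_Ioc
    exact mul_comm _ _
  have split : ∀ t, a t * ‖g t + w t * u t‖ ^ 2 +
        (a t + (a' t * w t + a t * w' t) - a t * w t ^ 2) * ‖u t‖ ^ 2 =
      (‖g t‖ ^ 2 + ‖u t‖ ^ 2) * a t + (((a' t * w t + a t * w' t) * (u t).re ^ 2
      + 2 * (a t * w t) * ((u t).re * (g t).re)) + ((a' t * w t + a t * w' t) * (u t).im ^ 2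
      + 2 * (a t * w t) * ((u t).im * (g t).im))) := by
    intro t
    simp only [Complex.sq_norm, Complex.normSq_apply, Complex.add_re, Complex.add_im,
      Complex.re_ofReal_mul, Complex.im_ofReal_mul]
    ring
  have h12 := integral_add i1 i2
  have h123 := integral_add i3 (i1.add i2)
  simp only [Pi.add_apply] at h123
  simp only [split]
  rw [h123, h12, Ire, Iim]
  simp

/-- Second-order approximate solution of the Riccati equation `(a w)' = a w² - a` for
`a = 1 + κ e τ + K (e τ)²`. -/
noncomputable def approxRiccati (e κ K τ : ℝ) : ℝ :=
  1 + e * κ / 2 + e ^ 2 * ((K - κ ^ 2 / 2) * τ + (K / 2 - κ ^ 2 / 8))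

theorem hasDerivAt_approxRiccati (e κ K τ : ℝ) :
    HasDerivAt (approxRiccati e κ K) (e ^ 2 * (K - κ ^ 2 / 2)) τ := by
  have := ((((hasDerivAt_id τ).const_mul (K - κ ^ 2 / 2)).add_const (K / 2 - κ ^ 2 / 8)).const_mul
    (e ^ 2)).const_add (1 + e * κ / 2)
  rw [mul_one] at this
  exact this

theorem hasDerivAt_wt (m κ K τ : ℝ) :
    HasDerivAt (wt m κ K) (m⁻¹ * (κ + 2 * K * (m⁻¹ * τ))) τ := by
  have h1 : HasDerivAt (fun t : ℝ => t * κ / m) (1 * κ / m) τ :=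
    ((hasDerivAt_id τ).mul_const κ).div_const m
  have h2 : HasDerivAt (fun t : ℝ => t ^ 2 * K / m ^ 2) (2 * τ * K / m ^ 2) τ := by
    simpa using ((hasDerivAt_pow 2 τ).mul_const K).div_const (m ^ 2)
  have := (h1.const_add 1).add h2
  refine HasDerivAt.congr_deriv this ?_
  ring

theorem wt_eq (m κ K τ : ℝ) : wt m κ K τ = 1 + κ * (m⁻¹ * τ) + K * (m⁻¹ * τ) ^ 2 := by
  simp only [wt, div_eq_mul_inv, mul_pow, inv_pow]
  ring

theorem exists_bound_of_continuous_params {F : ℝ → ℝ → ℝ → ℝ → ℝ}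
    (hF : Continuous fun p : ℝ × ℝ × ℝ × ℝ => F p.1 p.2.1 p.2.2.1 p.2.2.2) (A B : ℝ) :
    ∃ M, 0 < M ∧ ∀ x e κ K : ℝ, x ∈ Icc 0 1 → e ∈ Icc 0 1 → |κ| ≤ A → |K| ≤ B →
      |F x e κ K| ≤ M := by
  have hc : IsCompact (Icc (0 : ℝ) 1 ×ˢ Icc (0 : ℝ) 1 ×ˢ Icc (-A) A ×ˢ Icc (-B) B) :=
    isCompact_Icc.prod (isCompact_Icc.prod (isCompact_Icc.prod isCompact_Icc))
  obtain ⟨M, hM⟩ := hc.exists_bound_of_continuousOn hF.continuousOn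
  refine ⟨max M 1, by positivity, fun x e κ K hx he hκ hK => le_max_of_le_left ?_⟩
  exact hM (x, e, κ, K) ⟨hx, he, abs_le.1 hκ, abs_le.1 hK⟩

/-- The Riccati defect of `approxRiccati` for the weight `wt`. -/
noncomputable def riccatiDefect (m κ K τ : ℝ) : ℝ :=
  wt m κ K τ + (m⁻¹ * (κ + 2 * K * (m⁻¹ * τ)) * approxRiccati m⁻¹ κ K τ
    + wt m κ K τ * (m⁻¹ ^ 2 * (K - κ ^ 2 / 2))) - wt m κ K τ * approxRiccati m⁻¹ κ K τ ^ 2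

theorem exists_bound_wt (A B : ℝ) :
    ∃ M, 0 < M ∧ ∀ m κ K τ : ℝ, 1 ≤ m → |κ| ≤ A → |K| ≤ B → m⁻¹ * τ ∈ Icc 0 1 →
      |wt m κ K τ| ≤ M := by
  obtain ⟨M, hM, h⟩ := exists_bound_of_continuous_params
    (F := fun x _ κ K => 1 + κ * x + K * x ^ 2) (by fun_prop) A B
  refine ⟨M, hM, fun m κ K τ hm hκ hK hx => ?_⟩
  rw [wt_eq]
  exact h _ 0 _ _ hx (by simp) hκ hK

theorem exists_bound_deriv_wt (A B : ℝ) :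
    ∃ M, 0 < M ∧ ∀ m κ K τ : ℝ, 1 ≤ m → |κ| ≤ A → |K| ≤ B → m⁻¹ * τ ∈ Icc 0 1 →
      |m⁻¹ * (κ + 2 * K * (m⁻¹ * τ))| ≤ M * m⁻¹ := by
  obtain ⟨M, hM, h⟩ := exists_bound_of_continuous_params
    (F := fun x _ κ K => κ + 2 * K * x) (by fun_prop) A B
  refine ⟨M, hM, fun m κ K τ hm hκ hK hx => ?_⟩
  have hm0 : 0 ≤ m⁻¹ := by positivity
  rw [abs_mul, abs_of_nonneg hm0, mul_comm]
  exact mul_le_mul_of_nonneg_right (h _ 0 _ _ hx (by simp) hκ hK) hm0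

theorem exists_bound_approxRiccati_sub_one (A B : ℝ) :
    ∃ M, 0 < M ∧ ∀ m κ K τ : ℝ, 1 ≤ m → |κ| ≤ A → |K| ≤ B → m⁻¹ * τ ∈ Icc 0 1 →
      |approxRiccati m⁻¹ κ K τ - 1| ≤ M * m⁻¹ := by
  obtain ⟨M, hM, h⟩ := exists_bound_of_continuous_params
    (F := fun x e κ K => κ / 2 + (K - κ ^ 2 / 2) * x + e * (K / 2 - κ ^ 2 / 8)) (by fun_prop) A B
  refine ⟨M, hM, fun m κ K τ hm hκ hK hx => ?_⟩
  have hm0 : 0 ≤ m⁻¹ := by positivity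
  have hq : approxRiccati m⁻¹ κ K τ - 1 =
      (κ / 2 + (K - κ ^ 2 / 2) * (m⁻¹ * τ) + m⁻¹ * (K / 2 - κ ^ 2 / 8)) * m⁻¹ := by
    simp only [approxRiccati]
    ring
  rw [hq, abs_mul, abs_of_nonneg hm0]
  exact mul_le_mul_of_nonneg_right
    (h _ m⁻¹ _ _ hx ⟨hm0, inv_le_one_of_one_le₀ hm⟩ hκ hK) hm0

theorem exists_bound_riccatiDefect (A B : ℝ) :
    ∃ M, 0 < M ∧ ∀ m κ K τ : ℝ, 1 ≤ m → |κ| ≤ A → |K| ≤ B → 0 ≤ τ → m⁻¹ * τ ∈ Icc 0 1 →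
      |riccatiDefect m κ K τ| ≤ M * m⁻¹ ^ 3 * (1 + τ ^ 2) := by
  obtain ⟨M₁, hM₁, h₁⟩ := exists_bound_of_continuous_params
    (F := fun x _ κ K => 2 * (K - κ ^ 2 / 2) * κ + K * κ + 2 * (K - κ ^ 2 / 2) * K * x)
    (by fun_prop) A B
  obtain ⟨M₂, hM₂, h₂⟩ := exists_bound_of_continuous_params
    (F := fun x _ κ K => ((K - κ ^ 2 / 2) - 2 * (K / 2 - κ ^ 2 / 8)) * (κ + K * x)
      - (κ + K * x) * (κ / 2 + (K - κ ^ 2 / 2) * x) ^ 2 - (K - κ ^ 2 / 2) ^ 2 * x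
      + K * κ + 2 * K * (K - κ ^ 2 / 2) * x) (by fun_prop) A B
  obtain ⟨M₃, hM₃, h₃⟩ := exists_bound_of_continuous_params
    (F := fun x e κ K => (κ + 2 * K * x) * (K / 2 - κ ^ 2 / 8) - (1 + κ * x + K * x ^ 2) *
      (2 * (κ / 2 + (K - κ ^ 2 / 2) * x) * (K / 2 - κ ^ 2 / 8) + e * (K / 2 - κ ^ 2 / 8) ^ 2))
    (by fun_prop) A B
  refine ⟨M₁ + M₂ + M₃, by positivity, fun m κ K τ hm hκ hK hτ hx => ?_⟩
  have hm0 : 0 ≤ m⁻¹ := by positivity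
  have he : m⁻¹ ∈ Icc (0 : ℝ) 1 := ⟨hm0, inv_le_one_of_one_le₀ hm⟩
  specialize h₁ _ _ κ K hx he hκ hK
  specialize h₂ _ _ κ K hx he hκ hK
  specialize h₃ _ _ κ K hx he hκ hK
  simp only [riccatiDefect, wt_eq, approxRiccati]
  generalize m⁻¹ = e at *
  rw [abs_le] at h₁ h₂ h₃
  set p₁ := 2 * (K - κ ^ 2 / 2) * κ + K * κ + 2 * (K - κ ^ 2 / 2) * K * (e * τ) with hp₁
  set p₂ := ((K - κ ^ 2 / 2) - 2 * (K / 2 - κ ^ 2 / 8)) * (κ + K * (e * τ))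
      - (κ + K * (e * τ)) * (κ / 2 + (K - κ ^ 2 / 2) * (e * τ)) ^ 2
      - (K - κ ^ 2 / 2) ^ 2 * (e * τ)
      + K * κ + 2 * K * (K - κ ^ 2 / 2) * (e * τ) with hp₂
  set p₃ := (κ + 2 * K * (e * τ)) * (K / 2 - κ ^ 2 / 8) - (1 + κ * (e * τ) + K * (e * τ) ^ 2) *
      (2 * (κ / 2 + (K - κ ^ 2 / 2) * (e * τ)) * (K / 2 - κ ^ 2 / 8)
        + e * (K / 2 - κ ^ 2 / 8) ^ 2) with hp₃
  have key : ∀ z, z = e ^ 3 * (-p₁ * τ ^ 2 + p₂ * τ + p₃) →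
      |z| ≤ (M₁ + M₂ + M₃) * e ^ 3 * (1 + τ ^ 2) := by
    rintro z rfl
    rw [abs_mul, abs_of_nonneg (pow_nonneg hm0 3), mul_comm _ (e ^ 3), mul_assoc]
    refine mul_le_mul_of_nonneg_left ?_ (pow_nonneg hm0 3)
    have hτ2 : τ ≤ 1 + τ ^ 2 := by nlinarith [sq_nonneg (τ - 1)]
    have a₁ : |-p₁ * τ ^ 2| ≤ M₁ * (1 + τ ^ 2) := by
      rw [abs_mul, abs_neg, abs_of_nonneg (sq_nonneg τ)]
      exact mul_le_mul (abs_le.2 h₁) (by linarith) (sq_nonneg τ) hM₁.le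
    have a₂ : |p₂ * τ| ≤ M₂ * (1 + τ ^ 2) := by
      rw [abs_mul, abs_of_nonneg hτ]
      exact mul_le_mul (abs_le.2 h₂) hτ2 hτ hM₂.le
    have a₃ : |p₃| ≤ M₃ * (1 + τ ^ 2) :=
      (abs_le.2 h₃).trans (le_mul_of_one_le_right hM₃.le (by linarith [sq_nonneg τ]))
    calc |-p₁ * τ ^ 2 + p₂ * τ + p₃| ≤ |-p₁ * τ ^ 2| + |p₂ * τ| + |p₃| := abs_add_three _ _ _
      _ ≤ (M₁ + M₂ + M₃) * (1 + τ ^ 2) := by linarith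
  apply key
  rw [hp₁, hp₂, hp₃]
  ring

theorem inv_mul_mem_Icc_of_le_sqrt {m τ : ℝ} (hm : 1 ≤ m) (hτ : τ ∈ Icc 0 √m) :
    m⁻¹ * τ ∈ Icc (0 : ℝ) 1 := by
  have hm0 : 0 < m := by linarith
  refine ⟨mul_nonneg (by positivity) hτ.1, ?_⟩
  rw [inv_mul_le_one₀ hm0]
  exact hτ.2.trans ((Real.sqrt_le_left hm0.le).2 (by nlinarith))

/-- A supersolution of the Riccati equation bounds the energy from below by its initial value. -/
theorem le_energy_of_riccati {m κ K : ℝ} {w w' : ℝ → ℝ}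
    (hw : ∀ t, HasDerivAt w (w' t) t) (hw' : Continuous w')
    (ha : ∀ t ∈ Icc 0 √m, 0 ≤ wt m κ K t)
    (hr : ∀ t ∈ Icc 0 √m, 0 ≤ wt m κ K t + (m⁻¹ * (κ + 2 * K * (m⁻¹ * t)) * w t
      + wt m κ K t * w' t) - wt m κ K t * w t ^ 2)
    {u g : ℝ → ℂ} (hu : Adm m u g) : w 0 ≤ energy m κ K u g := by
  rw [energy, weighted_energy_eq (Real.sqrt_nonneg m) (hasDerivAt_wt m κ K) hw (by fun_prop) hw'
    hu.1 hu.2.1 hu.2.2]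
  have : wt m κ K 0 = 1 := by simp [wt]
  rw [this, one_mul]
  refine le_add_of_nonneg_right (setIntegral_nonneg measurableSet_Ioc fun t ht => ?_)
  have ht' := Ioc_subset_Icc_self ht
  exact add_nonneg (mul_nonneg (ha t ht') (sq_nonneg _)) (mul_nonneg (hr t ht') (sq_nonneg _))

theorem exists_le_energy (A B : ℝ) :
    ∃ D m₀ : ℝ, 0 < D ∧ 0 < m₀ ∧ ∀ m κ K : ℝ, 1 ≤ m → m₀ ≤ m → |κ| ≤ A → |K| ≤ B →
      (∀ t ∈ Icc 0 √m, 1 / 2 ≤ wt m κ K t) → ∀ u g, Adm m u g →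
      approxRiccati m⁻¹ κ K 0 - D * m⁻¹ ^ 3 ≤ energy m κ K u g := by
  obtain ⟨Ma, hMa, ha⟩ := exists_bound_wt A B
  obtain ⟨Md, hMd, hd⟩ := exists_bound_deriv_wt A B
  obtain ⟨Mw, hMw, hw⟩ := exists_bound_approxRiccati_sub_one A B
  obtain ⟨Mr, hMr, hr⟩ := exists_bound_riccatiDefect A B
  refine ⟨4 * Mr, 8 * (2 * Ma * Mw + Md + 12 * Ma * Mr), by positivity, by positivity,
    fun m κ K hm hm₀ hκ hK hhalf u g hu => ?_⟩
  have hm0 : 0 < m := by linarith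
  have he : 0 < m⁻¹ := by positivity
  have he1 : m⁻¹ ≤ 1 := inv_le_one_of_one_le₀ hm
  have hw₁ : ∀ t, HasDerivAt
      (fun t => approxRiccati m⁻¹ κ K t - 4 * Mr * m⁻¹ ^ 3 * (1 + t + t ^ 2))
      (m⁻¹ ^ 2 * (K - κ ^ 2 / 2) - 4 * Mr * m⁻¹ ^ 3 * (1 + 2 * t)) t := by
    intro t
    have h1 := ((hasDerivAt_id t).const_add 1).add (hasDerivAt_pow 2 t)
    have := (hasDerivAt_approxRiccati m⁻¹ κ K t).sub (h1.const_mul (4 * Mr * m⁻¹ ^ 3))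
    refine HasDerivAt.congr_deriv this ?_
    simp
  have := le_energy_of_riccati hw₁ (by fun_prop)
    (fun t ht => le_trans (by norm_num) (hhalf t ht)) (fun t ht => ?_) hu
  · simpa using this
  have hx := inv_mul_mem_Icc_of_le_sqrt hm ht
  have ht0 := ht.1
  have hts : t ^ 2 ≤ m := (Real.le_sqrt ht0 hm0.le).1 ht.2
  have hes : m⁻¹ * t ^ 2 ≤ 1 := by rw [inv_mul_le_one₀ hm0]; exact hts
  have hsmall : m⁻¹ * (8 * (2 * Ma * Mw + Md + 12 * Ma * Mr)) ≤ 1 := by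
    rw [inv_mul_le_one₀ hm0]; exact hm₀
  have ba := ha m κ K t hm hκ hK hx
  have bd := hd m κ K t hm hκ hK hx
  have bw := hw m κ K t hm hκ hK hx
  have br := hr m κ K t hm hκ hK ht0 hx
  have bh := hhalf t ht
  rw [riccatiDefect] at br
  set a := wt m κ K t
  set w := approxRiccati m⁻¹ κ K t
  set a' := m⁻¹ * (κ + 2 * K * (m⁻¹ * t))
  set w' := m⁻¹ ^ 2 * (K - κ ^ 2 / 2)
  generalize m⁻¹ = e at *
  set P := 1 + t + t ^ 2 with hP
  have hP0 : 0 ≤ P := by positivity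
  have hP1 : P ≤ 2 * (1 + t ^ 2) := by nlinarith [sq_nonneg (t - 1)]
  have heP : e ^ 3 * P ≤ 3 * e := by
    have : e * P ≤ 3 := by nlinarith [hx.2]
    calc e ^ 3 * P = e ^ 2 * (e * P) := by ring
      _ ≤ e ^ 2 * 3 := by gcongr
      _ ≤ 3 * e := by nlinarith
  have b1 : -(Ma * (Mw * e)) ≤ a * (w - 1) := by
    have : |a * (w - 1)| ≤ Ma * (Mw * e) := by
      rw [abs_mul]; exact mul_le_mul ba bw (abs_nonneg _) hMa.le
    exact (abs_le.1 this).1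
  have b2 : a * (4 * Mr * (e ^ 3 * P)) ≤ Ma * (4 * Mr * (3 * e)) :=
    mul_le_mul (abs_le.1 ba).2 (by gcongr) (by positivity) hMa.le
  have b3 := (abs_le.1 bd).2
  have b4 : -(e * (2 * Ma * Mw + Md + 12 * Ma * Mr)) ≤
      2 * (a * (w - 1)) - a' - a * (4 * Mr * (e ^ 3 * P)) := by linarith
  have b5 : -(1 / 8) * (2 * (1 + t ^ 2)) ≤
      (2 * (a * (w - 1)) - a' - a * (4 * Mr * (e ^ 3 * P))) * P := by
    have : -(1 / 8) ≤ 2 * (a * (w - 1)) - a' - a * (4 * Mr * (e ^ 3 * P)) := by linarith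
    nlinarith
  have b6 : 1 / 4 * (1 + t ^ 2) ≤ a * (1 + 2 * t ^ 2) +
      (2 * (a * (w - 1)) - a' - a * (4 * Mr * (e ^ 3 * P))) * P := by
    have : 1 / 2 * (1 + 2 * t ^ 2) ≤ a * (1 + 2 * t ^ 2) :=
      mul_le_mul_of_nonneg_right bh (by positivity)
    nlinarith [sq_nonneg t]
  have b7 := mul_le_mul_of_nonneg_left b6 (show 0 ≤ 4 * Mr * e ^ 3 by positivity)
  have b8 := (abs_le.1 br).1
  have : a + (a' * (w - 4 * Mr * e ^ 3 * P) + a * (w' - 4 * Mr * e ^ 3 * (1 + 2 * t)))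
      - a * (w - 4 * Mr * e ^ 3 * P) ^ 2 =
      (a + (a' * w + a * w') - a * w ^ 2) + 4 * Mr * e ^ 3 * (a * (1 + 2 * t ^ 2) +
      (2 * (a * (w - 1)) - a' - a * (4 * Mr * (e ^ 3 * P))) * P) := by
    rw [hP]; ring
  rw [this]
  linarith

/-- Primitive of `approxRiccati` vanishing at the origin. -/
noncomputable def approxRiccatiPrimitive (e κ K τ : ℝ) : ℝ :=
  (1 + e * κ / 2 + e ^ 2 * (K / 2 - κ ^ 2 / 8)) * τ + e ^ 2 * (K - κ ^ 2 / 2) * τ ^ 2 / 2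

theorem hasDerivAt_approxRiccatiPrimitive (e κ K τ : ℝ) :
    HasDerivAt (approxRiccatiPrimitive e κ K) (approxRiccati e κ K τ) τ := by
  have := ((hasDerivAt_id τ).const_mul (1 + e * κ / 2 + e ^ 2 * (K / 2 - κ ^ 2 / 8))).add
    (((hasDerivAt_pow 2 τ).const_mul (e ^ 2 * (K - κ ^ 2 / 2))).div_const 2)
  refine HasDerivAt.congr_deriv this ?_
  simp only [approxRiccati]
  push_cast
  ring

theorem exists_sub_le_approxRiccatiPrimitive (A B : ℝ) :
    ∃ c, 0 < c ∧ ∀ m κ K τ : ℝ, 1 ≤ m → |κ| ≤ A → |K| ≤ B → m⁻¹ * τ ∈ Icc 0 1 →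
      τ - c ≤ approxRiccatiPrimitive m⁻¹ κ K τ := by
  obtain ⟨c, hc, h⟩ := exists_bound_of_continuous_params
    (F := fun x e κ K => x * κ / 2 + e * (K / 2 - κ ^ 2 / 8) * x + (K - κ ^ 2 / 2) * x ^ 2 / 2)
    (by fun_prop) A B
  refine ⟨c, hc, fun m κ K τ hm hκ hK hx => ?_⟩
  have := (abs_le.1 (h _ m⁻¹ _ _ hx ⟨by positivity, inv_le_one_of_one_le₀ hm⟩ hκ hK)).1
  rw [approxRiccatiPrimitive]
  linarith

/-- A real `C¹` function and its derivative form an element of `H¹`. -/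
theorem isH1On_ofReal {R : ℝ} {f f' : ℝ → ℝ} (hf : ∀ t, HasDerivAt f (f' t) t)
    (hf' : Continuous f') : IsH1On R (fun t => (f t : ℂ)) (fun t => (f' t : ℂ)) := by
  have hc : Continuous fun t => (f' t : ℂ) := Complex.continuous_ofReal.comp hf'
  refine ⟨?_, fun x hx => ?_⟩
  · rw [memLp_two_iff_integrable_sq_norm hc.aestronglyMeasurable]
    exact ((hc.norm.pow 2).continuousOn.integrableOn_compact isCompact_Icc).mono_set
      Ioc_subset_Icc_self
  · rw [← intervalIntegral.integral_of_le hx.1,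
      intervalIntegral.integral_eq_sub_of_hasDerivAt (fun t _ => (hf t).ofReal_comp)
        (hc.intervalIntegrable _ _)]
    ring

theorem one_add_sq_mul_exp_le {t : ℝ} (ht : 0 ≤ t) :
    (1 + t ^ 2) * Real.exp (-(2 * t)) ≤ 3 * Real.exp (-t) := by
  have h := Real.pow_div_factorial_le_exp t ht 2
  have h1 := Real.one_le_exp ht
  have : (1 + t ^ 2) ≤ 3 * Real.exp t := by
    norm_num [Nat.factorial] at h
    linarith
  calc (1 + t ^ 2) * Real.exp (-(2 * t)) ≤ 3 * Real.exp t * Real.exp (-(2 * t)) := by gcongr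
    _ = 3 * Real.exp (-t) := by rw [mul_assoc, ← Real.exp_add]; ring_nf

theorem pow_four_mul_exp_le {t : ℝ} (ht : 0 ≤ t) :
    t ^ 4 * Real.exp (-(2 * t)) ≤ 24 * Real.exp (-t) := by
  have h := Real.pow_div_factorial_le_exp t ht 4
  have : t ^ 4 ≤ 24 * Real.exp t := by
    norm_num [Nat.factorial] at h
    linarith
  calc t ^ 4 * Real.exp (-(2 * t)) ≤ 24 * Real.exp t * Real.exp (-(2 * t)) := by gcongr
    _ = 24 * Real.exp (-t) := by rw [mul_assoc, ← Real.exp_add]; ring_nf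

theorem setIntegral_Ioc_le_of_le_exp {f : ℝ → ℝ} {R C : ℝ} (hC : 0 ≤ C)
    (h : ∀ t ∈ Ioc 0 R, f t ≤ C * Real.exp (-t)) : ∫ t in Ioc 0 R, f t ≤ C := by
  have hi : IntegrableOn (fun t => C * Real.exp (-t)) (Ioi 0) :=
    (integrableOn_exp_neg_Ioi 0).const_mul C
  by_cases hf : IntegrableOn f (Ioc 0 R)
  · calc ∫ t in Ioc 0 R, f t ≤ ∫ t in Ioc 0 R, C * Real.exp (-t) :=
          setIntegral_mono_on hf (hi.mono_set Ioc_subset_Ioi_self) measurableSet_Ioc h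
      _ ≤ ∫ t in Ioi (0 : ℝ), C * Real.exp (-t) :=
          setIntegral_mono_set hi (Filter.Eventually.of_forall fun t => by positivity)
            Ioc_subset_Ioi_self.eventuallyLE
      _ = C := by rw [integral_const_mul, integral_exp_neg_Ioi_zero, mul_one]
  · rw [integral_undef hf]
    exact hC

theorem exists_energy_le (A B : ℝ) :
    ∃ C, 0 < C ∧ ∀ m κ K : ℝ, 1 ≤ m → |κ| ≤ A → |K| ≤ B →
      (∀ t ∈ Icc 0 √m, 0 ≤ wt m κ K t) → ∃ u g, Adm m u g ∧
      energy m κ K u g ≤ approxRiccati m⁻¹ κ K 0 + C * m⁻¹ ^ 3 := by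
  obtain ⟨Ma, hMa, ha⟩ := exists_bound_wt A B
  obtain ⟨Mr, hMr, hr⟩ := exists_bound_riccatiDefect A B
  obtain ⟨c, hc, hW⟩ := exists_sub_le_approxRiccatiPrimitive A B
  refine ⟨Real.exp (2 * c) * (9 * Ma * 24 + Mr * 3), by positivity,
    fun m κ K hm hκ hK hpos => ?_⟩
  have hm0 : 0 < m := by linarith
  have hs : 0 < √m := Real.sqrt_pos.2 hm0
  have hs6 : (√m ^ 3) ^ 2 = m ^ 3 := by
    rw [← pow_mul, mul_comm, pow_mul, Real.sq_sqrt hm0.le]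
  set w := approxRiccati m⁻¹ κ K with hw
  set W := approxRiccatiPrimitive m⁻¹ κ K with hWdef
  have hWd : ∀ t, HasDerivAt W (w t) t := hasDerivAt_approxRiccatiPrimitive m⁻¹ κ K
  have hWc : Continuous W := continuous_iff_continuousAt.2 fun t => (hWd t).continuousAt
  have hwc : Continuous w :=
    continuous_iff_continuousAt.2 fun t => (hasDerivAt_approxRiccati m⁻¹ κ K t).continuousAt
  set f : ℝ → ℝ := fun t => Real.exp (-W t) * (1 - t ^ 3 / √m ^ 3) with hf
  set f' : ℝ → ℝ := fun t => Real.exp (-W t) * -w t * (1 - t ^ 3 / √m ^ 3)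
    + Real.exp (-W t) * -(3 * t ^ 2 / √m ^ 3) with hf'
  have hfd : ∀ t, HasDerivAt f (f' t) t := by
    intro t
    have h1 : HasDerivAt (fun t : ℝ => 1 - t ^ 3 / √m ^ 3) (-(3 * t ^ 2 / √m ^ 3)) t := by
      simpa using ((hasDerivAt_pow 3 t).div_const (√m ^ 3)).const_sub 1
    exact (hWd t).neg.exp.mul h1
  have hadm : Adm m (fun t => (f t : ℂ)) (fun t => (f' t : ℂ)) := by
    refine ⟨isH1On_ofReal hfd (by fun_prop), ?_, ?_⟩
    · simp [hf, hWdef, approxRiccatiPrimitive]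
    · simp [hf, hs.ne']
  refine ⟨_, _, hadm, ?_⟩
  rw [energy, weighted_energy_eq (Real.sqrt_nonneg m) (hasDerivAt_wt m κ K)
    (hasDerivAt_approxRiccati m⁻¹ κ K) (by fun_prop) (by fun_prop) hadm.1 hadm.2.1 hadm.2.2]
  have hwt0 : wt m κ K 0 = 1 := by simp [wt]
  rw [hwt0, one_mul]
  gcongr
  refine setIntegral_Ioc_le_of_le_exp (by positivity) fun t ht => ?_
  have ht' := Ioc_subset_Icc_self ht
  have hx := inv_mul_mem_Icc_of_le_sqrt hm ht'
  have ba := (abs_le.1 (ha m κ K t hm hκ hK hx)).2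
  have br := (abs_le.1 (hr m κ K t hm hκ hK ht.1.le hx)).2
  have bW := hW m κ K t hm hκ hK hx
  have hE : Real.exp (-W t) ^ 2 ≤ Real.exp (2 * c) * Real.exp (-(2 * t)) := by
    rw [← Real.exp_nat_mul, ← Real.exp_add, Real.exp_le_exp]
    push_cast
    linarith
  have hχ0 : 0 ≤ 1 - t ^ 3 / √m ^ 3 := by
    rw [sub_nonneg, div_le_one (by positivity)]
    exact pow_le_pow_left₀ ht.1.le ht.2 3
  have hχ1 : 1 - t ^ 3 / √m ^ 3 ≤ 1 := by
    have : 0 ≤ t ^ 3 / √m ^ 3 := by have := ht.1.le; positivity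
    linarith
  have e1 : ‖(f' t : ℂ) + (w t : ℂ) * (f t : ℂ)‖ ^ 2
      = 9 * t ^ 4 * m⁻¹ ^ 3 * Real.exp (-W t) ^ 2 := by
    rw [← Complex.ofReal_mul, ← Complex.ofReal_add, Complex.norm_real, Real.norm_eq_abs, sq_abs]
    have : f' t + w t * f t = -(3 * t ^ 2 * Real.exp (-W t)) / √m ^ 3 := by
      simp only [hf, hf']; ring
    rw [this, div_pow, hs6]
    field_simp
    ring
  have e2 : ‖(f t : ℂ)‖ ^ 2 ≤ Real.exp (-W t) ^ 2 := by
    rw [Complex.norm_real, Real.norm_eq_abs, sq_abs, hf, mul_pow]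
    exact mul_le_of_le_one_right (sq_nonneg _) (pow_le_one₀ hχ0 hχ1)
  have t4 := pow_four_mul_exp_le ht.1.le
  have t2 := one_add_sq_mul_exp_le ht.1.le
  have s1 : wt m κ K t * ‖(f' t : ℂ) + (w t : ℂ) * (f t : ℂ)‖ ^ 2 ≤
      Ma * (9 * t ^ 4 * m⁻¹ ^ 3 * (Real.exp (2 * c) * Real.exp (-(2 * t)))) := by
    rw [e1]
    gcongr
  have s2 : riccatiDefect m κ K t * ‖(f t : ℂ)‖ ^ 2 ≤
      Mr * m⁻¹ ^ 3 * (1 + t ^ 2) * (Real.exp (2 * c) * Real.exp (-(2 * t))) :=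
    mul_le_mul br (e2.trans hE) (sq_nonneg _) (by positivity)
  rw [riccatiDefect] at s2
  refine (add_le_add s1 s2).trans ?_
  have u1 := mul_le_mul_of_nonneg_left t4
    (show 0 ≤ 9 * Ma * m⁻¹ ^ 3 * Real.exp (2 * c) by positivity)
  have u2 := mul_le_mul_of_nonneg_left t2
    (show 0 ≤ Mr * m⁻¹ ^ 3 * Real.exp (2 * c) by positivity)
  linarith

theorem approxRiccati_zero (m κ K : ℝ) :
    approxRiccati m⁻¹ κ K 0 = 1 + κ / (2 * m) + (K / 2 - κ ^ 2 / 8) / m ^ 2 := by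
  simp only [approxRiccati, div_eq_mul_inv, mul_inv, inv_pow]
  ring

/-- Two-term asymptotic expansion of `Λ_{m,κ,K}`, uniform in `(κ, K)`:
`|Λ_{m,κ,K} − (1 + κ/(2m) + m⁻²(K/2 − κ²/8))| ≤ C m⁻³`. -/
theorem lam_asymptotics (A B m₁ : ℝ) (hA : 0 < A) (hB : 0 < B) (hm₁ : 1 ≤ m₁)
    (hwt : ∀ m, m₁ ≤ m → ∀ κ K τ : ℝ, |κ| ≤ A → |K| ≤ B →
      τ ∈ Icc 0 (Real.sqrt m) → 1 / 2 ≤ wt m κ K τ) :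
    ∃ C : ℝ, 0 < C ∧ ∀ m κ K : ℝ, m₁ ≤ m → |κ| ≤ A → |K| ≤ B →
      |lam m κ K - (1 + κ / (2 * m) + (K / 2 - κ ^ 2 / 8) / m ^ 2)| ≤ C / m ^ 3 := by
  obtain ⟨C₁, hC₁, hup⟩ := exists_energy_le A B
  obtain ⟨D, m₀, hD, hm₀, hlow⟩ := exists_le_energy A B
  obtain ⟨T, hT, hw⟩ := exists_bound_approxRiccati_sub_one A B
  refine ⟨C₁ + D + (1 + T) * m₀ ^ 3, by positivity, fun m κ K hm hκ hK => ?_⟩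
  have hm1 : 1 ≤ m := hm₁.trans hm
  have hm0 : 0 < m := by linarith
  have hhalf : ∀ t ∈ Icc 0 √m, 1 / 2 ≤ wt m κ K t := fun t ht => hwt m hm κ K t hκ hK ht
  have hpos : ∀ t ∈ Icc 0 √m, 0 ≤ wt m κ K t := fun t ht => by linarith [hhalf t ht]
  obtain ⟨u, g, hu, hE⟩ := hup m κ K hm1 hκ hK hpos
  have hnonneg : ∀ E ∈ {E : ℝ | ∃ u g : ℝ → ℂ, Adm m u g ∧ E = energy m κ K u g}, 0 ≤ E := by
    rintro _ ⟨u, g, -, rfl⟩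
    exact setIntegral_nonneg measurableSet_Ioc fun t ht =>
      mul_nonneg (by positivity) (hpos t (Ioc_subset_Icc_self ht))
  have hle : lam m κ K ≤ energy m κ K u g := csInf_le ⟨0, hnonneg⟩ ⟨u, g, hu, rfl⟩
  have hge : ∀ b, (∀ u g, Adm m u g → b ≤ energy m κ K u g) → b ≤ lam m κ K := by
    intro b hb
    refine le_csInf ⟨_, u, g, hu, rfl⟩ ?_
    rintro _ ⟨u, g, hu, rfl⟩
    exact hb u g hu
  have he3 : 0 ≤ m⁻¹ ^ 3 := by positivity
  have hTm : 0 ≤ (1 + T) * m₀ ^ 3 * m⁻¹ ^ 3 := by positivity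
  have hCm : 0 ≤ C₁ * m⁻¹ ^ 3 := by positivity
  have hDm : 0 ≤ D * m⁻¹ ^ 3 := by positivity
  rw [← approxRiccati_zero, div_eq_mul_inv _ (m ^ 3), ← inv_pow, abs_le]
  refine ⟨?_, by linarith⟩
  rcases le_total m₀ m with h | h
  · linarith [hge _ (hlow m κ K hm1 h hκ hK hhalf)]
  · have h0 : 0 ≤ lam m κ K := hge 0 fun u g hu => hnonneg _ ⟨u, g, hu, rfl⟩
    have h1 := (abs_le.1 (hw m κ K 0 hm1 hκ hK (by simp))).2
    have h2 : T * m⁻¹ ≤ T := mul_le_of_le_one_right hT.le (inv_le_one_of_one_le₀ hm1)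
    have h3 : 1 ≤ m₀ ^ 3 * m⁻¹ ^ 3 := by
      rw [← mul_pow]
      refine one_le_pow₀ ?_
      rw [← div_eq_mul_inv, one_le_div hm0]
      exact h
    nlinarith
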